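/- Let a ∈ ℂ and let ζ be a holomorphic function on an open neighborhood of a with ζ(a) = 0 and ζ′(a) ≠ 0. Set x := ζ² and let χ_n := x^{(n)}(a)/n! denote its Taylor coefficients at a (so χ₂ = ζ′(a)² ≠ 0). For z near a with z ≠ a, the function w ↦ 1/((z − w)²·ζ′(z)·ζ′(w)) − 1/((ζ(z) − ζ(w))²) extends holomorphically across w = z; call its value at w = z the diagonal value g(z). Then lim_{z→a} g(z) = (3χ₃² − 4χ₂χ₄)/(8χ₂³). In the paper's moduli x_{a,0} := x″(a), x_{a,n} := x^{(n+2)}(a)/x″(a), this equals (x_{a,1}² − x_{a,2})/(12·x_{a,0}), the coefficient B_{a,0;a,0} of Table 3. -/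

import Mathlib

open Filter

/-- Taylor's theorem with analytic remainder, centred at an arbitrary point. -/
theorem AnalyticAt.exists_eq_sum_sub_pow_mul {f : ℂ → ℂ} {z : ℂ} (hf : AnalyticAt ℂ f z) (n : ℕ) :
    ∃ F : ℂ → ℂ, AnalyticAt ℂ F z ∧ ∀ w, f w =
      (∑ i ∈ Finset.range n, (w - z) ^ i / i.factorial * iteratedDeriv i f z)
        + (w - z) ^ n * F w := by
  have h0 : AnalyticAt ℂ (fun h => f (z + h)) 0 :=
    AnalyticAt.comp_of_eq (g := f) (f := fun h => z + h) hf (by fun_prop) (by simp)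
  obtain ⟨F, hF, hFeq⟩ := h0.exists_eq_sum_add_pow_mul n
  refine ⟨fun w => F (w - z),
    AnalyticAt.comp_of_eq (g := F) (f := fun w => w - z) hF (by fun_prop) (by simp), fun w => ?_⟩
  simpa [iteratedDeriv_comp_const_add] using hFeq (w - z)

open Topology in
/-- The diagonal value of the regularised Bergman kernel in a local coordinate. -/
theorem tendsto_bergman_sub_diagonal {ζ : ℂ → ℂ} {z : ℂ} (hζ : AnalyticAt ℂ ζ z)
    (hd : deriv ζ z ≠ 0) :
    Tendsto (fun w : ℂ =>
        1 / ((z - w) ^ 2 * deriv ζ z * deriv ζ w) - 1 / (ζ z - ζ w) ^ 2) (𝓝[≠] z)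
      (𝓝 ((iteratedDeriv 2 ζ z ^ 2 / 4 - deriv ζ z * iteratedDeriv 3 ζ z / 6)
        / deriv ζ z ^ 4)) := by
  obtain ⟨F, hF, hFeq⟩ := hζ.exists_eq_sum_sub_pow_mul 4
  obtain ⟨E, hE, hEeq⟩ := hζ.deriv.exists_eq_sum_sub_pow_mul 3
  simp only [Finset.sum_range_succ, Finset.sum_range_zero, ← iteratedDeriv_succ',
    iteratedDeriv_zero, iteratedDeriv_one, Nat.factorial] at hFeq hEeq
  norm_num at hFeq hEeq
  set d₁ := deriv ζ z
  set d₂ := iteratedDeriv 2 ζ z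
  set d₃ := iteratedDeriv 3 ζ z
  let A : ℂ → ℂ := fun w =>
    d₁ + (w - z) * d₂ / 2 + (w - z) ^ 2 * d₃ / 6 + (w - z) ^ 3 * F w
  let B : ℂ → ℂ := fun w => d₁ + (w - z) * d₂ + (w - z) ^ 2 * d₃ / 2 + (w - z) ^ 3 * E w
  let C : ℂ → ℂ := fun w => d₂ ^ 2 / 4 - d₁ * d₃ / 6
    + (w - z) * (2 * d₁ * F w + d₂ * d₃ / 6 - d₁ * E w)
    + (w - z) ^ 2 * (d₃ ^ 2 / 36 + d₂ * F w) + (w - z) ^ 3 * (d₃ * F w / 3)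
    + (w - z) ^ 4 * F w ^ 2
  have hFc := hF.continuousAt
  have hEc := hE.continuousAt
  have hA : ContinuousAt A z := by fun_prop
  have hB : ContinuousAt B z := by fun_prop
  have hC : ContinuousAt C z := by fun_prop
  have hAz : A z = d₁ := by simp [A]
  have hBz : B z = d₁ := by simp [B]
  have hCz : C z = d₂ ^ 2 / 4 - d₁ * d₃ / 6 := by simp [C]
  have hlim : Tendsto (fun w => C w / (d₁ * B w * A w ^ 2)) (𝓝[≠] z)
      (𝓝 ((d₂ ^ 2 / 4 - d₁ * d₃ / 6) / d₁ ^ 4)) := by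
    have hc : ContinuousAt (fun w => C w / (d₁ * B w * A w ^ 2)) z :=
      hC.div (by fun_prop) (by simp [hAz, hBz, hd])
    have ht := hc.tendsto.mono_left (nhdsWithin_le_nhds (s := {z}ᶜ))
    rw [hAz, hBz, hCz] at ht
    convert ht using 3
    ring
  refine hlim.congr' ?_
  have hA0 : ∀ᶠ w in 𝓝[≠] z, A w ≠ 0 :=
    (hA.eventually_ne (by rwa [hAz])).filter_mono nhdsWithin_le_nhds
  have hB0 : ∀ᶠ w in 𝓝[≠] z, B w ≠ 0 :=
    (hB.eventually_ne (by rwa [hBz])).filter_mono nhdsWithin_le_nhds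
  filter_upwards [hA0, hB0, self_mem_nhdsWithin] with w hAw hBw hwz
  have hne : w - z ≠ 0 := sub_ne_zero.mpr hwz
  have h₁ : ζ z - ζ w = -((w - z) * A w) := by
    rw [hFeq w]
    simp only [A]
    ring
  have h₂ : deriv ζ w = B w := by
    rw [hEeq w]
    simp only [B]
    ring
  have h₃ : A w ^ 2 - d₁ * B w = (w - z) ^ 2 * C w := by
    simp only [A, B, C]
    ring
  have h₄ : (z - w) ^ 2 = (w - z) ^ 2 := by ring
  rw [h₁, h₂, h₄, neg_sq, mul_pow, div_sub_div _ _ (by positivity) (by positivity),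
    div_eq_div_iff (by positivity) (by positivity)]
  linear_combination (-(w - z) ^ 2 * d₁ * B w * A w ^ 2) * h₃

/-- Diagonal coefficient `B_{a,0;a,0}` of the Bergman kernel in a local
coordinate: if `ζ` is holomorphic near `a` with `ζ(a) = 0`, `ζ′(a) ≠ 0`,
`x = ζ²` with Taylor coefficients `χ_n = x^{(n)}(a)/n!`, and `g(z)` is the
diagonal value of the holomorphic extension of
`w ↦ 1/((z-w)²ζ′(z)ζ′(w)) - 1/(ζ(z)-ζ(w))²` across `w = z`, then
`g(z) → (3χ₃² - 4χ₂χ₄)/(8χ₂³)` as `z → a`, which in the moduli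
`x₀ = x″(a)`, `x₁ = x‴(a)/x″(a)`, `x₂ = x⁗(a)/x″(a)` equals
`(x₁² - x₂)/(12x₀)`. -/
theorem bergman_diagonal_coefficient (a : ℂ) (U : Set ℂ) (hU : IsOpen U)
    (haU : a ∈ U) (ζ : ℂ → ℂ) (hζ : DifferentiableOn ℂ ζ U)
    (hζa : ζ a = 0) (hζ' : deriv ζ a ≠ 0) (g : ℂ → ℂ)
    (hg : ∀ z ∈ U \ {a}, Tendsto
      (fun w : ℂ =>
        1 / ((z - w) ^ 2 * deriv ζ z * deriv ζ w) - 1 / (ζ z - ζ w) ^ 2)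
      (nhdsWithin z {z}ᶜ) (nhds (g z)))
    (χ : ℕ → ℂ)
    (hχ : ∀ n : ℕ, χ n =
      iteratedDeriv n (fun z : ℂ => ζ z ^ 2) a / (Nat.factorial n : ℂ)) :
    Tendsto g (nhdsWithin a {a}ᶜ)
      (nhds ((3 * χ 3 ^ 2 - 4 * χ 2 * χ 4) / (8 * χ 2 ^ 3))) ∧
    (3 * χ 3 ^ 2 - 4 * χ 2 * χ 4) / (8 * χ 2 ^ 3) =
      ((iteratedDeriv 3 (fun z : ℂ => ζ z ^ 2) a /
            iteratedDeriv 2 (fun z : ℂ => ζ z ^ 2) a) ^ 2 -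
          iteratedDeriv 4 (fun z : ℂ => ζ z ^ 2) a /
            iteratedDeriv 2 (fun z : ℂ => ζ z ^ 2) a) /
        (12 * iteratedDeriv 2 (fun z : ℂ => ζ z ^ 2) a) := by
  have hUa : U ∈ nhds a := hU.mem_nhds haU
  have han : ∀ z ∈ U, AnalyticAt ℂ ζ z := fun z hz => hζ.analyticAt (hU.mem_nhds hz)
  have haa := han a haU
  have hsq : ∀ n, iteratedDeriv n (fun z : ℂ => ζ z ^ 2) a = ∑ i ∈ Finset.range (n + 1),
      n.choose i * iteratedDeriv i ζ a * iteratedDeriv (n - i) ζ a := fun n => by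
    simp only [sq]
    exact iteratedDeriv_fun_mul haa.contDiffAt haa.contDiffAt
  have h2 := hsq 2
  have h3 := hsq 3
  have h4 := hsq 4
  simp [Finset.sum_range_succ, hζa, Nat.choose] at h2 h3 h4
  have hχ2 := hχ 2
  have hχ3 := hχ 3
  have hχ4 := hχ 4
  simp only [Nat.factorial] at hχ2 hχ3 hχ4
  rw [hχ2, hχ3, hχ4, h2, h3, h4]
  push_cast
  refine ⟨?_, by field_simp; ring⟩
  have hS : ContinuousAt (fun z => (iteratedDeriv 2 ζ z ^ 2 / 4
      - deriv ζ z * iteratedDeriv 3 ζ z / 6) / deriv ζ z ^ 4) a := by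
    have c1 : ContinuousAt (deriv ζ) a := haa.deriv.continuousAt
    have c2 : ContinuousAt (iteratedDeriv 2 ζ) a := by
      simpa only [iteratedDeriv_succ, iteratedDeriv_zero] using haa.deriv.deriv.continuousAt
    have c3 : ContinuousAt (iteratedDeriv 3 ζ) a := by
      simpa only [iteratedDeriv_succ, iteratedDeriv_zero] using haa.deriv.deriv.deriv.continuousAt
    exact ContinuousAt.div (by fun_prop) (by fun_prop) (pow_ne_zero _ hζ')
  have ht := hS.tendsto.mono_left (nhdsWithin_le_nhds (s := {a}ᶜ))
  convert ht.congr' ?_ using 2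
  · field_simp
    ring
  · filter_upwards [self_mem_nhdsWithin, nhdsWithin_le_nhds hUa, nhdsWithin_le_nhds
      (haa.deriv.continuousAt.eventually_ne hζ')] with z hza hzU hz
    exact tendsto_nhds_unique (tendsto_bergman_sub_diagonal (han z hzU) hz) (hg z ⟨hzU, hza⟩)
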